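/- There exist η > 0, C > 0 and X₀ > 0 such that the following holds for every integer X ≥ X₀. Let H = ⌊10·X^{1−γ+η}/γ⌋. Then for all reals M, N, V ≥ 1 with M ≤ X^{γ−1/2−4η} and V ≤ H, and all complex coefficients a_m (m ∼ M) and d_h (h a nonzero integer with |h| ∼ V) of modulus at most 1, one has |S₂*| ≤ C·X^{1−2η}, where S₂* = Σ_{m ∼ M} Σ_{n ∼ N, mn ∼ X} Σ_{|h| ∼ V} a_m·d_h·e(h·(mn)^γ), the sums running over positive integers m, n and nonzero integers h in the indicated ranges. -/

import Mathlib

open Finset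

noncomputable def e (z : ℝ) : ℂ := Complex.exp (2 * Real.pi * Complex.I * z)

noncomputable def nint (x : ℝ) : ℝ := |x - round x|

noncomputable def dyN (Y : ℝ) : Finset ℕ :=
  (Finset.range (⌈Y⌉₊ + 1)).filter fun m => Y/2 ≤ (m:ℝ) ∧ (m:ℝ) < Y

noncomputable def dyZ (Y : ℝ) : Finset ℤ :=
  (Finset.Icc (-(⌈Y⌉₊:ℤ)) (⌈Y⌉₊:ℤ)).filter fun l => l ≠ 0 ∧ Y/2 ≤ |(l:ℝ)| ∧ |(l:ℝ)| < Y


lemma norm_e (x : ℝ) : ‖e x‖ = 1 := by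
  have : e x = Complex.exp (((2 * Real.pi * x : ℝ) : ℂ) * Complex.I) := by
    unfold e; congr 1; push_cast; ring
  rw [this, Complex.norm_exp_ofReal_mul_I]

lemma e_add (x y : ℝ) : e (x + y) = e x * e y := by
  unfold e; rw [← Complex.exp_add]; congr 1; push_cast; ring

lemma e_intCast (k : ℤ) : e k = 1 := by
  unfold e
  rw [Complex.exp_eq_one_iff]
  exact ⟨k, by push_cast; ring⟩

lemma conj_e (x : ℝ) : (starRingEnd ℂ) (e x) = e (-x) := by
  unfold e
  rw [← Complex.exp_conj]
  congr 1
  simp [Complex.conj_ofNat]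

/-- The real and imaginary parts of `1 / (1 - e x)`. -/
noncomputable def invOneSubE (x : ℝ) : ℂ :=
  1 / 2 + ((Real.cos (Real.pi * x) / Real.sin (Real.pi * x) / 2 : ℝ) : ℂ) * Complex.I

lemma one_sub_e_mul_invOneSubE {x : ℝ} (hx : Real.sin (Real.pi * x) ≠ 0) :
    (1 - e x) * invOneSubE x = 1 := by
  have h1 : e x = Complex.cos (2 * (Real.pi * x)) + Complex.sin (2 * (Real.pi * x)) * Complex.I := by
    unfold e; rw [← Complex.exp_mul_I]; congr 1; ring
  have hs : Complex.sin (Real.pi * x) ≠ 0 := by exact_mod_cast hx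
  have h3 := Complex.sin_sq_add_cos_sq (Real.pi * x)
  rw [h1, Complex.cos_two_mul, Complex.sin_two_mul, invOneSubE]
  push_cast
  generalize Complex.sin (Real.pi * x) = s at *
  generalize Complex.cos (Real.pi * x) = c at *
  field_simp
  linear_combination (-2 * c * Complex.I) * h3 - 2 * c ^ 2 * s * Complex.I_sq

lemma two_mul_le_sin_pi_mul {δ x : ℝ} (hδ : 0 ≤ δ) (h1 : δ ≤ x) (h2 : x ≤ 1 - δ) :
    2 * δ ≤ Real.sin (Real.pi * x) := by
  have hp := Real.pi_pos
  rcases le_total x (1 / 2) with h | h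
  · have := Real.mul_le_sin (x := Real.pi * x) (by nlinarith) (by nlinarith)
    have h3 : 2 / Real.pi * (Real.pi * x) = 2 * x := by field_simp
    linarith
  · have := Real.mul_le_sin (x := Real.pi * (1 - x)) (by nlinarith) (by nlinarith)
    have h3 : 2 / Real.pi * (Real.pi * (1 - x)) = 2 * (1 - x) := by field_simp
    have h4 : Real.sin (Real.pi * (1 - x)) = Real.sin (Real.pi * x) := by
      rw [mul_sub, mul_one, Real.sin_pi_sub]
    linarith

lemma abs_cot_pi_mul_le {δ x : ℝ} (hδ : 0 < δ) (h1 : δ ≤ x) (h2 : x ≤ 1 - δ) :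
    |Real.cos (Real.pi * x) / Real.sin (Real.pi * x)| ≤ 1 / (2 * δ) := by
  have hs := two_mul_le_sin_pi_mul hδ.le h1 h2
  rw [abs_div, abs_of_pos (a := Real.sin _) (by linarith)]
  exact div_le_div₀ zero_le_one (Real.abs_cos_le_one _) (by linarith) hs

lemma cot_pi_mul_anti {x y : ℝ} (h0 : 0 < x) (hxy : x ≤ y) (h1 : y < 1) :
    Real.cos (Real.pi * y) / Real.sin (Real.pi * y) ≤
      Real.cos (Real.pi * x) / Real.sin (Real.pi * x) := by
  have hp := Real.pi_pos
  have hsx : 0 < Real.sin (Real.pi * x) :=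
    Real.sin_pos_of_pos_of_lt_pi (by positivity) (by nlinarith)
  have hsy : 0 < Real.sin (Real.pi * y) :=
    Real.sin_pos_of_pos_of_lt_pi (mul_pos hp (by linarith)) (by nlinarith)
  rw [div_le_div_iff₀ hsy hsx]
  have h := Real.sin_nonneg_of_nonneg_of_le_pi (x := Real.pi * y - Real.pi * x)
    (by nlinarith) (by nlinarith)
  rw [Real.sin_sub] at h
  linarith

lemma norm_invOneSubE_le {δ x : ℝ} (hδ : 0 < δ) (h1 : δ ≤ x) (h2 : x ≤ 1 - δ) :
    ‖invOneSubE x‖ ≤ 1 / (4 * δ) := by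
  have hs := two_mul_le_sin_pi_mul hδ.le h1 h2
  have hs0 : 0 < Real.sin (Real.pi * x) := by linarith
  have h3 := Real.sin_sq_add_cos_sq (Real.pi * x)
  have h4 : ‖invOneSubE x‖ ^ 2 = (1 / (2 * Real.sin (Real.pi * x))) ^ 2 := by
    rw [← Complex.normSq_eq_norm_sq, Complex.normSq_apply]
    simp only [invOneSubE, Complex.add_re, Complex.add_im, Complex.mul_re, Complex.mul_im,
      Complex.ofReal_re, Complex.ofReal_im, Complex.I_re, Complex.I_im]
    norm_num
    field_simp
    linarith
  have h5 : ‖invOneSubE x‖ = 1 / (2 * Real.sin (Real.pi * x)) :=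
    (pow_left_inj₀ (norm_nonneg _) (by positivity) two_ne_zero).1 h4
  rw [h5]
  exact one_div_le_one_div_of_le (by positivity) (by linarith)

lemma norm_invOneSubE_sub {x y : ℝ} (h0 : 0 < x) (hxy : x ≤ y) (h1 : y < 1) :
    ‖invOneSubE y - invOneSubE x‖ = (Real.cos (Real.pi * x) / Real.sin (Real.pi * x) -
      Real.cos (Real.pi * y) / Real.sin (Real.pi * y)) / 2 := by
  have h := cot_pi_mul_anti h0 hxy h1
  have h2 : invOneSubE y - invOneSubE x =
      (((Real.cos (Real.pi * y) / Real.sin (Real.pi * y) -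
        Real.cos (Real.pi * x) / Real.sin (Real.pi * x)) / 2 : ℝ) : ℂ) * Complex.I := by
    unfold invOneSubE; push_cast; ring
  rw [h2, norm_mul, Complex.norm_I, mul_one, Complex.norm_real, Real.norm_eq_abs,
    abs_of_nonpos (by linarith)]
  ring

/-- Kusmin–Landau inequality, with differences in `[δ, 1 - δ]`. -/
lemma norm_sum_Icc_e_le {δ : ℝ} (hδ : 0 < δ) (f : ℕ → ℝ) {a b : ℕ} (hab : a ≤ b)
    (hmono : MonotoneOn (fun n => f (n + 1) - f n) (Set.Icc a b))
    (hlo : ∀ n ∈ Set.Icc a b, δ ≤ f (n + 1) - f n)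
    (hhi : ∀ n ∈ Set.Icc a b, f (n + 1) - f n ≤ 1 - δ) :
    ‖∑ n ∈ Finset.Icc a b, e (f n)‖ ≤ 1 / δ := by
  set θ : ℕ → ℝ := fun n => f (n + 1) - f n with hθ
  set ct : ℕ → ℝ := fun n => Real.cos (Real.pi * θ n) / Real.sin (Real.pi * θ n) with hct
  have key : ∀ n ∈ Set.Icc a b,
      e (f n) + e (f (n + 1)) * invOneSubE (θ n) = e (f n) * invOneSubE (θ n) := by
    intro n hn
    have hs := two_mul_le_sin_pi_mul hδ.le (hlo n hn) (hhi n hn)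
    have h1 := one_sub_e_mul_invOneSubE (x := θ n) (by simp only [hθ]; linarith)
    have h2 : e (f (n + 1)) = e (f n) * e (θ n) := by
      rw [← e_add]; congr 1; simp only [hθ]; ring
    rw [h2]
    linear_combination (-e (f n)) * h1
  have main : ∀ c, a ≤ c → c ≤ b →
      ‖∑ n ∈ Finset.Icc a c, e (f n) + e (f (c + 1)) * invOneSubE (θ c)‖ ≤
        ‖invOneSubE (θ a)‖ + (ct a - ct c) / 2 := by
    intro c hc
    induction c, hc using Nat.le_induction with
    | base =>
      intro hb
      rw [Finset.Icc_self, Finset.sum_singleton, key a ⟨le_rfl, hb⟩, norm_mul, norm_e]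
      simp
    | succ c hc ih =>
      intro hb
      have hm1 : c ∈ Set.Icc a b := ⟨hc, by omega⟩
      have hm2 : c + 1 ∈ Set.Icc a b := ⟨by omega, hb⟩
      rw [Finset.sum_Icc_succ_top (by omega), add_assoc, key _ hm2]
      have h1 : ∑ n ∈ Finset.Icc a c, e (f n) + e (f (c + 1)) * invOneSubE (θ (c + 1)) =
          (∑ n ∈ Finset.Icc a c, e (f n) + e (f (c + 1)) * invOneSubE (θ c)) +
            e (f (c + 1)) * (invOneSubE (θ (c + 1)) - invOneSubE (θ c)) := by ring
      rw [h1]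
      refine (norm_add_le _ _).trans ?_
      rw [norm_mul, norm_e, one_mul, norm_invOneSubE_sub (hδ.trans_le (hlo c hm1))
        (hmono hm1 hm2 (by omega)) ((hhi _ hm2).trans_lt (by linarith))]
      have := ih (by omega)
      simp only [hct] at this ⊢
      linarith
  have ha : a ∈ Set.Icc a b := ⟨le_rfl, hab⟩
  have hb : b ∈ Set.Icc a b := ⟨hab, le_rfl⟩
  have h1 := main b hab le_rfl
  have h2 := norm_invOneSubE_le hδ (hlo a ha) (hhi a ha)
  have h3 := norm_invOneSubE_le hδ (hlo b hb) (hhi b hb)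
  have h4 := abs_le.1 (abs_cot_pi_mul_le hδ (hlo a ha) (hhi a ha))
  have h5 := abs_le.1 (abs_cot_pi_mul_le hδ (hlo b hb) (hhi b hb))
  have h6 : ‖∑ n ∈ Finset.Icc a b, e (f n)‖ ≤
      ‖∑ n ∈ Finset.Icc a b, e (f n) + e (f (b + 1)) * invOneSubE (θ b)‖ + ‖invOneSubE (θ b)‖ := by
    have := norm_sub_le (∑ n ∈ Finset.Icc a b, e (f n) + e (f (b + 1)) * invOneSubE (θ b))
      (e (f (b + 1)) * invOneSubE (θ b))
    rwa [add_sub_cancel_right, norm_mul, norm_e, one_mul] at this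
  have h7 : 1 / (4 * δ) + 1 / (4 * δ) + (1 / (2 * δ) + 1 / (2 * δ)) / 2 = 1 / δ := by
    field_simp; norm_num
  simp only [hct, hθ] at *
  linarith

lemma eq_Icc_of_ordConnected {S : Finset ℕ} (hS : (S : Set ℕ).OrdConnected) (hne : S.Nonempty) :
    S = Finset.Icc (S.min' hne) (S.max' hne) := by
  ext n
  rw [Finset.mem_Icc]
  exact ⟨fun h => ⟨S.min'_le n h, S.le_max' n h⟩,
    fun h => hS.out (S.min'_mem hne) (S.max'_mem hne) h⟩

/-- Kusmin–Landau inequality, with differences in `[k + δ, k + 1 - δ]` for an integer `k`. -/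
lemma norm_sum_e_le_one_div {δ : ℝ} (hδ : 0 < δ) (f : ℕ → ℝ) (k : ℤ) {S : Finset ℕ}
    (hS : (S : Set ℕ).OrdConnected)
    (hmono : MonotoneOn (fun n => f (n + 1) - f n) S)
    (hlo : ∀ n ∈ S, k + δ ≤ f (n + 1) - f n)
    (hhi : ∀ n ∈ S, f (n + 1) - f n ≤ k + 1 - δ) :
    ‖∑ n ∈ S, e (f n)‖ ≤ 1 / δ := by
  rcases S.eq_empty_or_nonempty with rfl | hne
  · simp [hδ.le]
  have hI := eq_Icc_of_ordConnected hS hne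
  have hab : S.min' hne ≤ S.max' hne := S.min'_le _ (S.max'_mem hne)
  generalize S.min' hne = a at *
  generalize S.max' hne = b at *
  subst hI
  have h := norm_sum_Icc_e_le hδ (fun n => f n - k * n) hab
    (fun x hx y hy hxy => by
      have := hmono (by simpa using hx) (by simpa using hy) hxy
      push_cast at this ⊢; linarith)
    (fun n hn => by have := hlo n (by simpa using hn); push_cast; linarith)
    (fun n hn => by have := hhi n (by simpa using hn); push_cast; linarith)
  convert h using 3 with n
  have : f n = (f n - k * n) + ((k * n : ℤ) : ℝ) := by push_cast; ring
  conv_lhs => rw [this, e_add, e_intCast, mul_one]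

lemma card_le_of_separated {θ : ℕ → ℝ} {lam p L : ℝ} (hlam : 0 < lam) (hL : 0 ≤ L) {S : Finset ℕ}
    (hsep : ∀ i ∈ S, ∀ j ∈ S, i ≤ j → ((j : ℝ) - i) * lam ≤ θ j - θ i)
    (hlo : ∀ n ∈ S, p ≤ θ n) (hhi : ∀ n ∈ S, θ n ≤ p + L) :
    (S.card : ℝ) ≤ L / lam + 1 := by
  rcases S.eq_empty_or_nonempty with rfl | hne
  · simp; positivity
  have ha := S.min'_mem hne
  have hb := S.max'_mem hne
  have hab : S.min' hne ≤ S.max' hne := S.min'_le _ hb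
  have hsub : S ⊆ Finset.Icc (S.min' hne) (S.max' hne) := fun n h =>
    Finset.mem_Icc.2 ⟨S.min'_le n h, S.le_max' n h⟩
  have h1 : (S.card : ℝ) ≤ ((S.max' hne + 1 - S.min' hne : ℕ) : ℝ) := by
    exact_mod_cast (Finset.card_le_card hsub).trans_eq (Nat.card_Icc _ _)
  rw [Nat.cast_sub (by omega)] at h1
  push_cast at h1
  have h2 := hsep _ ha _ hb hab
  have h3 := hlo _ ha
  have h4 := hhi _ hb
  have h5 : ((S.max' hne : ℝ) - S.min' hne) ≤ L / lam := by
    rw [le_div_iff₀ hlam]; linarith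
  linarith

lemma ordConnected_filter_of_monotoneOn {θ : ℕ → ℝ} {I : Finset ℕ} (hI : (I : Set ℕ).OrdConnected)
    (hθ : MonotoneOn θ I) {P : ℝ → Prop} [DecidablePred P] (hP : {x | P x}.OrdConnected) :
    ((I.filter fun n => P (θ n) : Finset ℕ) : Set ℕ).OrdConnected := by
  constructor
  intro x hx y hy z hz
  simp only [Finset.coe_filter, Set.mem_ofPred_eq] at hx hy ⊢
  have hzI : z ∈ I := hI.out hx.1 hy.1 hz
  exact ⟨hzI, hP.out hx.2 hy.2 ⟨hθ hx.1 hzI hz.1, hθ hzI hy.1 hz.2⟩⟩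

/-- Van der Corput's second derivative test, in terms of finite differences. -/
lemma norm_sum_e_le_of_separated {lam R : ℝ} (hlam : 0 < lam) (hlam1 : lam ≤ 1) (hR : 0 ≤ R)
    (f : ℕ → ℝ) {I : Finset ℕ} (hI : (I : Set ℕ).OrdConnected)
    (hsep : ∀ i ∈ I, ∀ j ∈ I, i ≤ j →
      ((j : ℝ) - i) * lam ≤ (f (j + 1) - f j) - (f (i + 1) - f i))
    (hlo : ∀ n ∈ I, -R ≤ f (n + 1) - f n) (hhi : ∀ n ∈ I, f (n + 1) - f n ≤ 0) :
    ‖∑ n ∈ I, e (f n)‖ ≤ 5 * (R + 2) / √lam := by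
  set θ : ℕ → ℝ := fun n => f (n + 1) - f n with hθ
  have hmono : MonotoneOn θ I := by
    intro x hx y hy hxy
    have h := hsep x hx y hy hxy
    have h1 : (x : ℝ) ≤ y := by exact_mod_cast hxy
    have h2 : 0 ≤ ((y : ℝ) - x) * lam := mul_nonneg (by linarith) hlam.le
    simp only [hθ]; linarith
  set s := √lam with hs
  have hs0 : 0 < s := Real.sqrt_pos.2 hlam
  have hss : s * s = lam := Real.mul_self_sqrt hlam.le
  have hs1 : s ≤ 1 := by nlinarith
  have fiber : ∀ k : ℤ, ‖∑ n ∈ I.filter (fun n => ⌊θ n⌋ = k), e (f n)‖ ≤ 5 / s := by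
    intro k
    set F := I.filter (fun n => ⌊θ n⌋ = k) with hF
    have hFI : ∀ n ∈ F, n ∈ I := fun n hn => (Finset.mem_filter.1 hn).1
    have hFk : ∀ n ∈ F, (k : ℝ) ≤ θ n ∧ θ n < k + 1 := fun n hn =>
      Int.floor_eq_iff.1 (Finset.mem_filter.1 hn).2
    have hFo : (F : Set ℕ).OrdConnected := by
      refine ordConnected_filter_of_monotoneOn hI hmono (P := fun x => ⌊x⌋ = k) ⟨?_⟩
      intro x hx y hy z hz
      exact le_antisymm ((Int.floor_mono hz.2).trans_eq hy) (hx.symm.trans_le (Int.floor_mono hz.1))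
    have hFm : MonotoneOn θ F := hmono.mono fun n hn => hFI n hn
    have small : ∀ (p : ℝ) (T : Finset ℕ), T ⊆ F → (∀ n ∈ T, p ≤ θ n) →
        (∀ n ∈ T, θ n ≤ p + s / 2) → ‖∑ n ∈ T, e (f n)‖ ≤ 1 / (2 * s) + 1 := by
      intro p T hT h1 h2
      have h3 := card_le_of_separated hlam (by positivity)
        (fun i hi j hj => hsep i (hFI _ (hT hi)) j (hFI _ (hT hj))) h1 h2
      have h4 : s / 2 / lam = 1 / (2 * s) := by rw [← hss]; field_simp
      calc ‖∑ n ∈ T, e (f n)‖ ≤ ∑ n ∈ T, ‖e (f n)‖ := norm_sum_le _ _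
        _ = T.card := by simp [norm_e]
        _ ≤ _ := by rw [← h4]; exact h3
    rw [← Finset.sum_filter_add_sum_filter_not F (fun n => θ n < k + s / 2),
      ← Finset.sum_filter_add_sum_filter_not (F.filter fun n => ¬ θ n < k + s / 2)
        (fun n => k + 1 - s / 2 < θ n)]
    have e1 := small k (F.filter fun n => θ n < k + s / 2) (Finset.filter_subset _ _)
      (fun n hn => (hFk n (Finset.mem_filter.1 hn).1).1)
      (fun n hn => (Finset.mem_filter.1 hn).2.le)
    have e2 := small (k + 1 - s / 2)
      ((F.filter fun n => ¬ θ n < k + s / 2).filter fun n => k + 1 - s / 2 < θ n)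
      ((Finset.filter_subset _ _).trans (Finset.filter_subset _ _))
      (fun n hn => (Finset.mem_filter.1 hn).2.le)
      (fun n hn => by
        have := (hFk n (Finset.mem_filter.1 (Finset.mem_filter.1 hn).1).1).2
        linarith)
    have e3 : ‖∑ n ∈ (F.filter fun n => ¬ θ n < k + s / 2).filter
        (fun n => ¬ k + 1 - s / 2 < θ n), e (f n)‖ ≤ 1 / (s / 2) := by
      have ho : (((F.filter fun n => ¬ θ n < k + s / 2).filter
          fun n => ¬ k + 1 - s / 2 < θ n : Finset ℕ) : Set ℕ).OrdConnected := by
        refine ordConnected_filter_of_monotoneOn (P := fun x => ¬ k + 1 - s / 2 < x)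
          (ordConnected_filter_of_monotoneOn (P := fun x => ¬ x < k + s / 2) hFo hFm ?_)
          (hFm.mono fun n hn => (Finset.mem_filter.1 (Finset.mem_coe.1 hn)).1) ?_
        · simp only [not_lt]; exact Set.ordConnected_Ici
        · simp only [not_lt]; exact Set.ordConnected_Iic
      refine norm_sum_e_le_one_div (by positivity) f k ho (hFm.mono ?_) ?_ ?_
      · intro n hn
        simp only [Finset.coe_filter, Finset.mem_filter, Set.mem_ofPred_eq] at hn
        exact hn.1.1
      · intro n hn
        simp only [Finset.mem_filter, not_lt] at hn
        exact hn.1.2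
      · intro n hn
        simp only [Finset.mem_filter, not_lt] at hn
        exact hn.2
    refine (norm_add_le _ _).trans ((add_le_add e1 ((norm_add_le _ _).trans
      (add_le_add e2 e3))).trans ?_)
    have h1 : 1 / (2 * s) + 1 + (1 / (2 * s) + 1 + 1 / (s / 2)) = 3 / s + 2 := by field_simp; ring
    have h2 : 2 ≤ 2 / s := by rw [le_div_iff₀ hs0]; linarith
    have h3 : 5 / s = 3 / s + 2 / s := by ring
    linarith
  have hmaps : ∀ n ∈ I, ⌊θ n⌋ ∈ Finset.Icc ⌊-R⌋ 0 := by
    intro n hn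
    rw [Finset.mem_Icc]
    refine ⟨Int.floor_mono (hlo n hn), ?_⟩
    simpa using Int.floor_mono (hhi n hn)
  rw [← Finset.sum_fiberwise_of_maps_to hmaps]
  refine (norm_sum_le _ _).trans ((Finset.sum_le_sum fun k _ => fiber k).trans ?_)
  rw [Finset.sum_const, nsmul_eq_mul, Int.card_Icc]
  have hfl : ⌊-R⌋ ≤ 0 := by simpa using Int.floor_mono (show -R ≤ (0 : ℝ) by linarith)
  have hc : (((0 + 1 - ⌊-R⌋).toNat : ℕ) : ℝ) ≤ R + 2 := by
    have h1 : (((0 + 1 - ⌊-R⌋).toNat : ℤ) : ℝ) = ((0 + 1 - ⌊-R⌋ : ℤ) : ℝ) := by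
      rw [Int.toNat_of_nonneg (by omega)]
    have h2 := Int.lt_floor_add_one (-R)
    rw [Int.cast_natCast] at h1
    rw [h1]; push_cast; linarith
  calc _ ≤ (R + 2) * (5 / s) := by gcongr
    _ = _ := by ring

lemma mul_rpow_le_rpow_sub_rpow_add_one {γ a B : ℝ} (h1 : γ < 1) (ha : 0 < a)
    (haB : a + 1 ≤ B) : (1 - γ) * B ^ (γ - 2) ≤ a ^ (γ - 1) - (a + 1) ^ (γ - 1) := by
  have hd : ∀ x, 0 < x →
      HasDerivAt (fun t : ℝ => -t ^ (γ - 1)) ((1 - γ) * x ^ (γ - 2)) x := by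
    intro x hx
    have h := (Real.hasDerivAt_rpow_const (p := γ - 1) (Or.inl hx.ne')).neg
    rw [show γ - 1 - 1 = γ - 2 by ring] at h
    exact h.congr_deriv (by ring)
  have h := (convex_Icc a (a + 1)).mul_sub_le_image_sub_of_le_deriv
    (f := fun t : ℝ => -t ^ (γ - 1)) (C := (1 - γ) * B ^ (γ - 2))
    (fun x hx => (hd x (ha.trans_le hx.1)).continuousAt.continuousWithinAt)
    (fun x hx => (hd x (ha.trans_le
      (interior_subset hx : x ∈ Set.Icc a (a + 1)).1)).differentiableAt.differentiableWithinAt)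
    (fun x hx => by
      have hx' : x ∈ Set.Icc a (a + 1) := interior_subset hx
      have hx0 := ha.trans_le hx'.1
      rw [(hd x hx0).deriv]
      exact mul_le_mul_of_nonneg_left (Real.rpow_le_rpow_of_nonpos hx0 (hx'.2.trans haB)
        (by linarith)) (by linarith))
    a (by simp) (a + 1) (by simp) (by linarith)
  linarith

lemma mul_le_rpow_second_diff {γ x y B : ℝ} (h0 : 0 < γ) (h1 : γ < 1) (hx : 0 < x) (hxy : x ≤ y)
    (hyB : y + 1 ≤ B) : γ * (1 - γ) * B ^ (γ - 2) * (y - x) ≤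
      ((x + 1) ^ γ - x ^ γ) - ((y + 1) ^ γ - y ^ γ) := by
  have hd : ∀ t, 0 < t → HasDerivAt (fun t : ℝ => t ^ γ - (t + 1) ^ γ)
      (γ * (t ^ (γ - 1) - (t + 1) ^ (γ - 1))) t := by
    intro t ht
    have e1 := Real.hasDerivAt_rpow_const (p := γ) (Or.inl ht.ne')
    have e2 := ((hasDerivAt_id t).add_const 1).rpow_const (p := γ)
      (Or.inl (by simp only [id]; linarith))
    exact (e1.sub e2).congr_deriv (by simp only [id]; ring)
  have h := (convex_Icc x y).mul_sub_le_image_sub_of_le_deriv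
    (f := fun t : ℝ => t ^ γ - (t + 1) ^ γ) (C := γ * (1 - γ) * B ^ (γ - 2))
    (fun t ht => (hd t (hx.trans_le ht.1)).continuousAt.continuousWithinAt)
    (fun t ht => (hd t (hx.trans_le
      (interior_subset ht : t ∈ Set.Icc x y).1)).differentiableAt.differentiableWithinAt)
    (fun t ht => by
      have ht' : t ∈ Set.Icc x y := interior_subset ht
      have ht0 := hx.trans_le ht'.1
      rw [(hd t ht0).deriv, mul_assoc]
      exact mul_le_mul_of_nonneg_left (mul_rpow_le_rpow_sub_rpow_add_one h1 ht0
        (by linarith [ht'.2])) h0.le)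
    x (by simp [hxy]) y (by simp [hxy]) hxy
  linarith

lemma rpow_add_one_sub_rpow_le {γ x : ℝ} (h1 : γ < 1) (hx : 0 < x) :
    (x + 1) ^ γ - x ^ γ ≤ x ^ (γ - 1) := by
  have e1 : (x + 1) ^ γ = (x + 1) ^ (γ - 1) * (x + 1) := by
    rw [← Real.rpow_add_one (by linarith)]; ring_nf
  have e2 : x ^ γ = x ^ (γ - 1) * x := by
    rw [← Real.rpow_add_one hx.ne']; ring_nf
  have e3 : (x + 1) ^ (γ - 1) ≤ x ^ (γ - 1) :=
    Real.rpow_le_rpow_of_nonpos hx (by linarith) (by linarith)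
  rw [e1, e2]
  nlinarith

lemma norm_sum_e_neg_rpow_le {γ A Y : ℝ} (h0 : 0 < γ) (h1 : γ < 1) (hA : 0 < A) (hY : 0 < Y)
    (hlam : γ * (1 - γ) / 4 * (A * Y ^ (γ - 2)) ≤ 1) {I : Finset ℕ}
    (hI : (I : Set ℕ).OrdConnected) (hlo : ∀ n ∈ I, Y / 2 ≤ n) (hhi : ∀ n ∈ I, (n : ℝ) < Y) :
    ‖∑ n ∈ I, e (-(A * (n : ℝ) ^ γ))‖ ≤
      5 * (2 * (A * Y ^ (γ - 1)) + 2) / √(γ * (1 - γ) / 4 * (A * Y ^ (γ - 2))) := by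
  have h1' : 0 < 1 - γ := by linarith
  have hpos : ∀ n ∈ I, (0 : ℝ) < n := fun n hn => by linarith [hlo n hn]
  refine norm_sum_e_le_of_separated (by positivity) hlam (by positivity) _ hI ?_ ?_ ?_
  · intro i hi j hj hij
    have hj1 : (1 : ℝ) ≤ j := by
      have := hpos j hj
      exact_mod_cast (show 0 < j by exact_mod_cast this)
    have hij' : (i : ℝ) ≤ j := by exact_mod_cast hij
    have h := mul_le_rpow_second_diff h0 h1 (hpos i hi) hij' (B := 2 * Y)
      (by linarith [hhi j hj])
    have h2 : Y ^ (γ - 2) / 4 ≤ (2 * Y) ^ (γ - 2) := by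
      rw [Real.mul_rpow (by norm_num) hY.le]
      have : (2 : ℝ) ^ (-2 : ℝ) ≤ 2 ^ (γ - 2) :=
        Real.rpow_le_rpow_of_exponent_le (by norm_num) (by linarith)
      have h4 : (2 : ℝ) ^ (-2 : ℝ) = 1 / 4 := by
        rw [Real.rpow_neg (by norm_num)]; norm_num
      rw [h4] at this
      have h5 : 0 < Y ^ (γ - 2) := by positivity
      linarith [mul_le_mul_of_nonneg_right this h5.le]
    have h3 : γ * (1 - γ) * (Y ^ (γ - 2) / 4) * ((j : ℝ) - i) ≤
        γ * (1 - γ) * (2 * Y) ^ (γ - 2) * ((j : ℝ) - i) := by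
      have : 0 ≤ (j : ℝ) - i := by linarith
      gcongr
    have h4 := mul_le_mul_of_nonneg_left (h3.trans h) hA.le
    push_cast
    linarith
  · intro n hn
    have h := rpow_add_one_sub_rpow_le h1 (hpos n hn)
    have h2 : (n : ℝ) ^ (γ - 1) ≤ (Y / 2) ^ (γ - 1) :=
      Real.rpow_le_rpow_of_nonpos (by positivity) (hlo n hn) (by linarith)
    have h3 : (Y / 2) ^ (γ - 1) ≤ 2 * Y ^ (γ - 1) := by
      rw [div_eq_inv_mul, Real.mul_rpow (by norm_num) hY.le, Real.inv_rpow (by norm_num),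
        ← Real.rpow_neg (by norm_num)]
      have : (2 : ℝ) ^ (-(γ - 1)) ≤ 2 ^ (1 : ℝ) :=
        Real.rpow_le_rpow_of_exponent_le (by norm_num) (by linarith)
      rw [Real.rpow_one] at this
      gcongr
    have h4 := mul_le_mul_of_nonneg_left (h.trans (h2.trans h3)) hA.le
    push_cast
    linarith
  · intro n hn
    have : (n : ℝ) ^ γ ≤ ((n : ℝ) + 1) ^ γ :=
      Real.rpow_le_rpow (hpos n hn).le (by linarith) h0.le
    have := mul_le_mul_of_nonneg_left this hA.le
    push_cast
    linarith

lemma norm_sum_e_neg (I : Finset ℕ) (f : ℕ → ℝ) :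
    ‖∑ n ∈ I, e (-f n)‖ = ‖∑ n ∈ I, e (f n)‖ := by
  simp_rw [← conj_e]
  rw [← map_sum, Complex.norm_conj]

/-- The bound for the inner sum over a range of `n` with `m * n` of size `X`. -/
lemma norm_sum_e_mul_rpow_le {γ t m X : ℝ} (h0 : 0 < γ) (h1 : γ < 1) (ht : t ≠ 0) (hm : 0 < m)
    (hX : 0 < X) (hlam : γ * (1 - γ) / 4 * (|t| * m ^ 2 * X ^ (γ - 2)) ≤ 1) {I : Finset ℕ}
    (hI : (I : Set ℕ).OrdConnected) (hlo : ∀ n ∈ I, X / 2 ≤ m * n)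
    (hhi : ∀ n ∈ I, m * (n : ℝ) < X) :
    ‖∑ n ∈ I, e (t * (m * (n : ℝ)) ^ γ)‖ ≤
      10 / √(γ * (1 - γ) / 4) * (√|t| * X ^ (γ / 2) + X ^ (1 - γ / 2) / (m * √|t|)) := by
  have h1' : 0 < 1 - γ := by linarith
  have ht' : 0 < |t| := abs_pos.2 ht
  set κ := γ * (1 - γ) / 4 with hκ
  have hκ0 : 0 < κ := by positivity
  have e1 : ‖∑ n ∈ I, e (t * (m * (n : ℝ)) ^ γ)‖ =
      ‖∑ n ∈ I, e (-(|t| * m ^ γ * (n : ℝ) ^ γ))‖ := by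
    rw [norm_sum_e_neg]
    have e2 : ∀ n : ℕ, |t| * m ^ γ * (n : ℝ) ^ γ = |t| * (m * (n : ℝ)) ^ γ := fun n => by
      rw [Real.mul_rpow hm.le (Nat.cast_nonneg n)]; ring
    simp_rw [e2]
    rcases abs_choice t with h | h
    · rw [h]
    · rw [h]; simp_rw [neg_mul]; rw [norm_sum_e_neg]
  have e2 : |t| * m ^ γ * (X / m) ^ (γ - 2) = |t| * m ^ 2 * X ^ (γ - 2) := by
    rw [Real.div_rpow hX.le hm.le, show m ^ γ = m ^ (γ - 2) * m ^ 2 by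
      rw [← Real.rpow_natCast, ← Real.rpow_add hm]; congr 1; push_cast; ring]
    field_simp
  have e3 : |t| * m ^ γ * (X / m) ^ (γ - 1) = |t| * m * X ^ (γ - 1) := by
    rw [Real.div_rpow hX.le hm.le, show m ^ γ = m ^ (γ - 1) * m by
      rw [← Real.rpow_add_one hm.ne']; congr 1; ring]
    field_simp
  have h := norm_sum_e_neg_rpow_le (γ := γ) (A := |t| * m ^ γ) (Y := X / m) h0 h1
    (by positivity) (by positivity) (by rw [e2]; exact hlam) hI
    (fun n hn => by
      rw [div_div, div_le_iff₀ (by positivity)]; linarith [hlo n hn])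
    (fun n hn => by rw [lt_div_iff₀ hm]; linarith [hhi n hn])
  rw [e2, e3, ← hκ] at h
  rw [e1]
  refine h.trans_eq ?_
  have e4 : √(κ * (|t| * m ^ 2 * X ^ (γ - 2))) = √κ * (√|t| * m * X ^ (γ / 2 - 1)) := by
    rw [Real.sqrt_eq_iff_mul_self_eq (by positivity) (by positivity)]
    have s1 := Real.mul_self_sqrt hκ0.le
    have s2 := Real.mul_self_sqrt ht'.le
    have s3 : X ^ (γ / 2 - 1) * X ^ (γ / 2 - 1) = X ^ (γ - 2) := by
      rw [← Real.rpow_add hX]; congr 1; ring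
    rw [← s3]
    linear_combination (-(√|t| * m * X ^ (γ / 2 - 1)) ^ 2) * s1 -
      κ * (m * X ^ (γ / 2 - 1)) ^ 2 * s2
  rw [e4]
  have s2 := Real.mul_self_sqrt ht'.le
  have e5 : X ^ (γ - 1) = X ^ (γ / 2 - 1) * X ^ (γ / 2) := by
    rw [← Real.rpow_add hX]; congr 1; ring
  have e6 : X ^ (1 - γ / 2) = (X ^ (γ / 2 - 1))⁻¹ := by
    rw [← Real.rpow_neg hX.le]; congr 1; ring
  have hk : 0 < √κ := Real.sqrt_pos.2 hκ0
  have hst : 0 < √|t| := Real.sqrt_pos.2 ht'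
  have hx : 0 < X ^ (γ / 2 - 1) := by positivity
  rw [e5, e6]
  generalize X ^ (γ / 2 - 1) = u at *
  generalize X ^ (γ / 2) = w at *
  generalize √|t| = q at *
  rw [← s2]
  field_simp
  ring

lemma card_dyN_le {Y : ℝ} (hY : 1 ≤ Y) : ((dyN Y).card : ℝ) ≤ 3 * Y := by
  have h1 : (dyN Y).card ≤ ⌈Y⌉₊ + 1 := (Finset.card_filter_le _ _).trans_eq (Finset.card_range _)
  have h2 := Nat.ceil_lt_add_one (show 0 ≤ Y by linarith)
  have h3 : ((dyN Y).card : ℝ) ≤ ⌈Y⌉₊ + 1 := by exact_mod_cast h1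
  linarith

lemma card_dyZ_le {Y : ℝ} (hY : 1 ≤ Y) : ((dyZ Y).card : ℝ) ≤ 5 * Y := by
  have h1 : (dyZ Y).card ≤ 2 * ⌈Y⌉₊ + 1 := by
    refine (Finset.card_filter_le _ _).trans_eq ?_
    rw [Int.card_Icc]; omega
  have h2 := Nat.ceil_lt_add_one (show 0 ≤ Y by linarith)
  have h3 : ((dyZ Y).card : ℝ) ≤ 2 * ⌈Y⌉₊ + 1 := by exact_mod_cast h1
  linarith

lemma ordConnected_filter_dyN (N X : ℝ) (m : ℕ) :
    (((dyN N).filter fun n => X / 2 ≤ ((m * n : ℕ) : ℝ) ∧ ((m * n : ℕ) : ℝ) < X : Finset ℕ) :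
      Set ℕ).OrdConnected := by
  constructor
  intro x hx y hy z hz
  simp only [dyN, Finset.coe_filter, Finset.mem_filter, Finset.mem_range,
    Set.mem_ofPred_eq] at hx hy ⊢
  have a1 : (x : ℝ) ≤ z := by exact_mod_cast hz.1
  have a2 : (z : ℝ) ≤ y := by exact_mod_cast hz.2
  have a3 : ((m * x : ℕ) : ℝ) ≤ ((m * z : ℕ) : ℝ) := by exact_mod_cast Nat.mul_le_mul_left m hz.1
  have a4 : ((m * z : ℕ) : ℝ) ≤ ((m * y : ℕ) : ℝ) := by exact_mod_cast Nat.mul_le_mul_left m hz.2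
  exact ⟨⟨hz.2.trans_lt hy.1.1, by linarith [hx.1.2.1], by linarith [hy.1.2.2]⟩,
    by linarith [hx.2.1], by linarith [hy.2.2]⟩

lemma norm_typeI_sum_le {γ η X M N V : ℝ} (h0 : 8 / 9 ≤ γ) (h1 : γ < 1) (hη : 0 < η)
    (hη1 : η ≤ 1 / 9) (hX : 1 ≤ X) (hM : 1 ≤ M) (hV : 1 ≤ V)
    (hMX : M ≤ X ^ (γ - 1 / 2 - 4 * η)) (hVX : V ≤ 10 / γ * X ^ (1 - γ + η))
    (am : ℕ → ℂ) (dh : ℤ → ℂ)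
    (ham : ∀ m ∈ dyN M, ‖am m‖ ≤ 1) (hdh : ∀ h ∈ dyZ V, ‖dh h‖ ≤ 1) :
    ‖∑ m ∈ dyN M,
        ∑ n ∈ (dyN N).filter (fun n => X / 2 ≤ ((m * n : ℕ) : ℝ) ∧ ((m * n : ℕ) : ℝ) < X),
        ∑ h ∈ dyZ V, am m * dh h * e ((h : ℝ) * ((m : ℝ) * (n : ℝ)) ^ γ)‖ ≤
      450 / √(γ * (1 - γ) / 4) * (10 / γ) ^ 2 * X ^ (1 - 2 * η) := by
  have hγ : 0 < γ := by linarith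
  have h1' : 0 < 1 - γ := by linarith
  have hX0 : 0 < X := by linarith
  have hM0 : 0 < M := by linarith
  have hV0 : 0 < V := by linarith
  set κ := γ * (1 - γ) / 4 with hκ
  have hκ0 : 0 < κ := by positivity
  have hk : 0 < √κ := Real.sqrt_pos.2 hκ0
  set D := 10 / γ with hD
  have hD1 : 1 ≤ D := by rw [hD, le_div_iff₀ hγ]; linarith
  have inner : ∀ m ∈ dyN M, ∀ h ∈ dyZ V,
      ‖∑ n ∈ (dyN N).filter (fun n => X / 2 ≤ ((m * n : ℕ) : ℝ) ∧ ((m * n : ℕ) : ℝ) < X),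
        e ((h : ℝ) * ((m : ℝ) * (n : ℝ)) ^ γ)‖ ≤
      10 / √κ * (√V * X ^ (γ / 2) + 2 * (X ^ (1 - γ / 2) / M)) := by
    intro m hm h hh
    obtain ⟨-, hm1, hm2⟩ := Finset.mem_filter.1 hm
    obtain ⟨-, hh0, hh1, hh2⟩ := Finset.mem_filter.1 hh
    have hm0 : (0 : ℝ) < m := by linarith
    have hhr : (1 : ℝ) ≤ |(h : ℝ)| := by exact_mod_cast Int.one_le_abs hh0
    have hlam : κ * (|(h : ℝ)| * (m : ℝ) ^ 2 * X ^ (γ - 2)) ≤ 1 := by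
      have b1 : |(h : ℝ)| ≤ D * X ^ (1 - γ + η) := by linarith
      have b2 : (m : ℝ) ≤ X ^ (γ - 1 / 2 - 4 * η) := by linarith
      have b3 : κ * D ≤ 1 := by rw [hκ, hD]; field_simp; linarith
      calc κ * (|(h : ℝ)| * (m : ℝ) ^ 2 * X ^ (γ - 2))
          ≤ κ * (D * X ^ (1 - γ + η) * (X ^ (γ - 1 / 2 - 4 * η)) ^ 2 * X ^ (γ - 2)) := by gcongr
        _ = κ * D * X ^ (2 * γ - 2 - 7 * η) := by
          rw [← Real.rpow_natCast, ← Real.rpow_mul hX0.le]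
          have : X ^ (2 * γ - 2 - 7 * η) = X ^ (1 - γ + η) *
              X ^ ((γ - 1 / 2 - 4 * η) * (2 : ℕ)) * X ^ (γ - 2) := by
            rw [← Real.rpow_add hX0, ← Real.rpow_add hX0]; congr 1; push_cast; ring
          rw [this]; ring
        _ ≤ 1 * 1 := by
          gcongr
          exact Real.rpow_le_one_of_one_le_of_nonpos hX (by linarith)
        _ = 1 := one_mul 1
    refine (norm_sum_e_mul_rpow_le hγ h1 (by exact_mod_cast hh0) hm0 hX0 hlam
      (ordConnected_filter_dyN N X m)
      (fun n hn => by have := (Finset.mem_filter.1 hn).2.1; push_cast at this; exact this)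
      (fun n hn => by have := (Finset.mem_filter.1 hn).2.2; push_cast at this; exact this)).trans ?_
    have c1 : √|(h : ℝ)| ≤ √V := Real.sqrt_le_sqrt hh2.le
    have c2 : (1 : ℝ) ≤ √|(h : ℝ)| := Real.one_le_sqrt.2 hhr
    have c3 : X ^ (1 - γ / 2) / (m * √|(h : ℝ)|) ≤ X ^ (1 - γ / 2) / (M / 2) := by
      have : M / 2 ≤ m * √|(h : ℝ)| := by nlinarith
      gcongr
    have c4 : X ^ (1 - γ / 2) / (M / 2) = 2 * (X ^ (1 - γ / 2) / M) := by field_simp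
    rw [c4] at c3
    rw [← hκ]
    gcongr
  have step : ∀ m ∈ dyN M,
      ‖∑ n ∈ (dyN N).filter (fun n => X / 2 ≤ ((m * n : ℕ) : ℝ) ∧ ((m * n : ℕ) : ℝ) < X),
        ∑ h ∈ dyZ V, am m * dh h * e ((h : ℝ) * ((m : ℝ) * (n : ℝ)) ^ γ)‖ ≤
      5 * V * (10 / √κ * (√V * X ^ (γ / 2) + 2 * (X ^ (1 - γ / 2) / M))) := by
    intro m hm
    rw [Finset.sum_comm]
    refine (norm_sum_le_of_le (n := fun _ => 10 / √κ *
      (√V * X ^ (γ / 2) + 2 * (X ^ (1 - γ / 2) / M))) _ fun h hh => ?_).trans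
      ((Finset.sum_const _).trans_le ?_)
    · rw [← Finset.mul_sum, norm_mul, norm_mul]
      refine (mul_le_of_le_one_left (norm_nonneg _) ?_).trans (inner m hm h hh)
      exact mul_le_one₀ (ham m hm) (norm_nonneg _) (hdh h hh)
    · rw [nsmul_eq_mul]
      exact mul_le_mul_of_nonneg_right (card_dyZ_le hV) (by positivity)
  refine (norm_sum_le_of_le _ step).trans ?_
  rw [Finset.sum_const, nsmul_eq_mul]
  refine (mul_le_mul_of_nonneg_right (card_dyN_le hM) (by positivity)).trans ?_
  have f1 : 3 * M * (5 * V * (10 / √κ * (√V * X ^ (γ / 2) + 2 * (X ^ (1 - γ / 2) / M)))) =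
      150 / √κ * (M * (V * √V) * X ^ (γ / 2) + 2 * (V * X ^ (1 - γ / 2))) := by
    field_simp; ring
  rw [f1]
  have hVs : √V ≤ D * X ^ ((1 - γ + η) / 2) := by
    refine Real.sqrt_le_iff.2 ⟨by positivity, hVX.trans ?_⟩
    rw [mul_pow, ← Real.rpow_natCast (X ^ _), ← Real.rpow_mul hX0.le,
      show (1 - γ + η) / 2 * ((2 : ℕ) : ℝ) = 1 - γ + η by push_cast; ring]
    gcongr
    nlinarith
  have g1 : M * (V * √V) * X ^ (γ / 2) ≤ D ^ 2 * X ^ (1 - 2 * η) := by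
    calc M * (V * √V) * X ^ (γ / 2) ≤ X ^ (γ - 1 / 2 - 4 * η) *
          (D * X ^ (1 - γ + η) * (D * X ^ ((1 - γ + η) / 2))) * X ^ (γ / 2) := by gcongr
      _ = D ^ 2 * X ^ (1 - 5 / 2 * η) := by
        have : X ^ (1 - 5 / 2 * η) = X ^ (γ - 1 / 2 - 4 * η) * X ^ (1 - γ + η) *
            X ^ ((1 - γ + η) / 2) * X ^ (γ / 2) := by
          rw [← Real.rpow_add hX0, ← Real.rpow_add hX0, ← Real.rpow_add hX0]; congr 1; ring
        rw [this]; ring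
      _ ≤ D ^ 2 * X ^ (1 - 2 * η) := by
        gcongr
        norm_num
  have g2 : V * X ^ (1 - γ / 2) ≤ D ^ 2 * X ^ (1 - 2 * η) := by
    calc V * X ^ (1 - γ / 2) ≤ D * X ^ (1 - γ + η) * X ^ (1 - γ / 2) := by gcongr
      _ = D * X ^ (2 - 3 / 2 * γ + η) := by
        rw [mul_assoc, ← Real.rpow_add hX0]; congr 2; ring
      _ ≤ D ^ 2 * X ^ (1 - 2 * η) := by
        gcongr
        · nlinarith
        · linarith
  calc 150 / √κ * (M * (V * √V) * X ^ (γ / 2) + 2 * (V * X ^ (1 - γ / 2)))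
      ≤ 150 / √κ * (D ^ 2 * X ^ (1 - 2 * η) + 2 * (D ^ 2 * X ^ (1 - 2 * η))) := by gcongr
    _ = _ := by ring

theorem S2_small (c γ : ℝ) (hc1 : 1 < c) (hc2 : c < 9/8) (hγ : γ = 1/c) :
    ∃ η > (0:ℝ), ∃ C > (0:ℝ), ∃ X₀ > (0:ℝ), ∀ X : ℕ, X₀ ≤ (X:ℝ) →
    ∀ M N V : ℝ, 1 ≤ M → 1 ≤ N → 1 ≤ V →
    M ≤ (X:ℝ)^(γ-1/2-4*η) → V ≤ (⌊10 * (X:ℝ)^(1-γ+η) / γ⌋₊ : ℝ) →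
    ∀ am : ℕ → ℂ, ∀ dh : ℤ → ℂ,
    (∀ m ∈ dyN M, ‖am m‖ ≤ 1) → (∀ h ∈ dyZ V, ‖dh h‖ ≤ 1) →
    ‖∑ m ∈ dyN M, ∑ n ∈ (dyN N).filter (fun n => (X:ℝ)/2 ≤ ((m*n:ℕ):ℝ) ∧ ((m*n:ℕ):ℝ) < (X:ℝ)),
        ∑ h ∈ dyZ V, am m * dh h * e ((h:ℝ) * ((m:ℝ)*(n:ℝ))^γ)‖ ≤ C * (X:ℝ)^(1-2*η) := by
  have hγ0 : 8 / 9 ≤ γ := by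
    rw [hγ, le_div_iff₀ (by linarith)]; linarith
  have hγ1 : γ < 1 := by
    rw [hγ, div_lt_one (by linarith)]; exact hc1
  have hp : 0 < γ * (1 - γ) / 4 := by
    have : 0 < 1 - γ := by linarith
    positivity
  have hs : 0 < √(γ * (1 - γ) / 4) := Real.sqrt_pos.2 hp
  refine ⟨1 / 100, by norm_num, 450 / √(γ * (1 - γ) / 4) * (10 / γ) ^ 2, by positivity, 1,
    one_pos, ?_⟩
  intro X hX M N V hM _ hV hMX hVX am dh ham hdh
  refine norm_typeI_sum_le hγ0 hγ1 (by norm_num) (by norm_num) hX hM hV hMX ?_ am dh ham hdh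
  refine hVX.trans ((Nat.floor_le (by positivity)).trans_eq ?_)
  ring
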